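/- Let (Ω, ℱ, P) be a probability space carrying two independent standard Gaussian random variables Z₁ and Z₂. Let ρ ∈ (−1,1), μX, μY ∈ ℝ, vX > 0, vY > 0, and define X := μX + √vX·Z₁ and Y := μY + √vY·(ρ·Z₁ + √(1−ρ²)·Z₂). Then for all u > 0, c > 0 and d ∈ ℝ, setting w := (log(u/c) − μY)/√vY and ξ := (d − μX)/√vX, it holds that E[(u − c·e^Y)₊ · 1_{{X ≤ d}}] = u·Φ₂(w, ξ; ρ) − c·e^{μY + vY/2}·Φ₂(w − √vY, ξ − ρ·√vY; ρ). -/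

import Mathlib

open MeasureTheory ProbabilityTheory

/-- The standard bivariate normal cumulative distribution function `Φ₂(x, y; ρ)`. -/
noncomputable def biGaussianCDF (x y ρ : ℝ) : ℝ :=
  (2 * Real.pi * Real.sqrt (1 - ρ ^ 2))⁻¹ *
    ∫ u in Set.Iio x, ∫ v in Set.Iio y,
      Real.exp (-(u ^ 2 + v ^ 2 - 2 * ρ * u * v) / (2 * (1 - ρ ^ 2)))

lemma aux_phi (t : ℝ) : gaussianPDFReal 0 1 t = (Real.sqrt (2 * Real.pi))⁻¹ * Real.exp (- t^2/2) := by
  simp [gaussianPDFReal]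

lemma aux_phiphi (t z : ℝ) : gaussianPDFReal 0 1 t * gaussianPDFReal 0 1 z
    = (2 * Real.pi)⁻¹ * Real.exp (- (t^2 + z^2)/2) := by
  have h : (Real.sqrt (2 * Real.pi))⁻¹ * (Real.sqrt (2 * Real.pi))⁻¹ = (2 * Real.pi)⁻¹ := by
    rw [← mul_inv, Real.mul_self_sqrt (by positivity)]
  rw [aux_phi, aux_phi, ← h]
  have : - (t^2 + z^2)/2 = - t^2/2 + - z^2/2 := by ring
  rw [this, Real.exp_add]; ring

lemma aux_int : Integrable (fun p : ℝ × ℝ => gaussianPDFReal 0 1 p.1 * gaussianPDFReal 0 1 p.2) :=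
  (integrable_gaussianPDFReal 0 1).mul_prod (integrable_gaussianPDFReal 0 1)

lemma aux_law {Ω : Type*} [MeasurableSpace Ω]
    (P : Measure Ω) [IsProbabilityMeasure P]
    (Z₁ Z₂ : Ω → ℝ) (hZ₁ : Measurable Z₁) (hZ₂ : Measurable Z₂)
    (h₁ : P.map Z₁ = gaussianReal 0 1) (h₂ : P.map Z₂ = gaussianReal 0 1)
    (hindep : IndepFun Z₁ Z₂ P) (F : ℝ × ℝ → ℝ) (hF : Measurable F) :
    ∫ ω, F (Z₁ ω, Z₂ ω) ∂P =
      ∫ p : ℝ × ℝ, F p * (gaussianPDFReal 0 1 p.1 * gaussianPDFReal 0 1 p.2) := by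
  have hm := (indepFun_iff_map_prod_eq_prod_map_map hZ₁.aemeasurable hZ₂.aemeasurable).1 hindep
  rw [← integral_map (f := F) (φ := fun ω => (Z₁ ω, Z₂ ω)) (by fun_prop)
    hF.aestronglyMeasurable, hm, h₁, h₂, gaussianReal_of_var_ne_zero _ one_ne_zero,
    prod_withDensity (by fun_prop) (by fun_prop),
    integral_withDensity_eq_integral_toReal_smul (by fun_prop)]
  · refine integral_congr_ae (.of_forall fun p => ?_)
    simp [ENNReal.toReal_mul, toReal_gaussianPDF]
    ring
  · refine .of_forall fun p => ENNReal.mul_lt_top ?_ ?_ <;> exact gaussianPDF_lt_top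

lemma aux_tilt (ρ s t z : ℝ) (hρ : ρ ∈ Set.Ioo (-1 : ℝ) 1) :
    Real.exp (s * (ρ * t + Real.sqrt (1 - ρ ^ 2) * z)) *
      (gaussianPDFReal 0 1 t * gaussianPDFReal 0 1 z) =
    Real.exp (s ^ 2 / 2) * (gaussianPDFReal 0 1 (t - ρ * s) *
      gaussianPDFReal 0 1 (z - Real.sqrt (1 - ρ ^ 2) * s)) := by
  have hr : Real.sqrt (1 - ρ ^ 2) ^ 2 = 1 - ρ ^ 2 :=
    Real.sq_sqrt (by nlinarith [hρ.1, hρ.2])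
  rw [aux_phiphi, aux_phiphi, mul_left_comm, mul_left_comm (Real.exp _), ← Real.exp_add,
    ← Real.exp_add]
  congr 2
  linear_combination (- s ^ 2 / 2) * hr * (-1)

lemma aux_tilt_int (ρ s : ℝ) (hρ : ρ ∈ Set.Ioo (-1 : ℝ) 1) :
    Integrable (fun p : ℝ × ℝ => Real.exp (s * (ρ * p.1 + Real.sqrt (1 - ρ ^ 2) * p.2)) *
      (gaussianPDFReal 0 1 p.1 * gaussianPDFReal 0 1 p.2)) := by
  simp_rw [aux_tilt ρ s _ _ hρ]
  refine Integrable.const_mul ?_ _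
  exact ((integrable_gaussianPDFReal 0 1).comp_sub_right _).mul_prod
    ((integrable_gaussianPDFReal 0 1).comp_sub_right _)

def auxS (ρ x y : ℝ) : Set (ℝ × ℝ) :=
  {p | p.1 ≤ y ∧ ρ * p.1 + Real.sqrt (1 - ρ ^ 2) * p.2 < x}

lemma auxS_meas (ρ x y : ℝ) : MeasurableSet (auxS ρ x y) := by
  have h1 : MeasurableSet {p : ℝ × ℝ | p.1 ≤ y} :=
    measurableSet_le (by fun_prop) (by fun_prop)
  have h2 : MeasurableSet {p : ℝ × ℝ | ρ * p.1 + Real.sqrt (1 - ρ ^ 2) * p.2 < x} :=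
    measurableSet_lt (by fun_prop) (by fun_prop)
  exact h1.inter h2

lemma aux_shift (ρ s x y : ℝ) (hρ : ρ ∈ Set.Ioo (-1 : ℝ) 1) :
    ∫ p in auxS ρ x y, Real.exp (s * (ρ * p.1 + Real.sqrt (1 - ρ ^ 2) * p.2)) *
      (gaussianPDFReal 0 1 p.1 * gaussianPDFReal 0 1 p.2) =
    Real.exp (s ^ 2 / 2) * ∫ p in auxS ρ (x - s) (y - ρ * s),
      gaussianPDFReal 0 1 p.1 * gaussianPDFReal 0 1 p.2 := by
  have hr : Real.sqrt (1 - ρ ^ 2) ^ 2 = 1 - ρ ^ 2 :=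
    Real.sq_sqrt (by nlinarith [hρ.1, hρ.2])
  simp_rw [aux_tilt ρ s _ _ hρ]
  rw [integral_const_mul, ← integral_indicator (auxS_meas _ _ _),
    ← integral_indicator (auxS_meas _ _ _),
    ← integral_add_right_eq_self _ ((ρ * s, Real.sqrt (1 - ρ ^ 2) * s) : ℝ × ℝ)]
  congr 1
  refine integral_congr_ae (.of_forall fun p => ?_)
  have : p + (ρ * s, Real.sqrt (1 - ρ ^ 2) * s) ∈ auxS ρ x y ↔
      p ∈ auxS ρ (x - s) (y - ρ * s) := by
    simp only [auxS, Set.mem_ofPred_eq, Prod.fst_add, Prod.snd_add]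
    have e : ρ * (p.1 + ρ * s) + Real.sqrt (1 - ρ ^ 2) * (p.2 + Real.sqrt (1 - ρ ^ 2) * s)
      = ρ * p.1 + Real.sqrt (1 - ρ ^ 2) * p.2 + s := by linear_combination s * hr
    rw [e, le_sub_iff_add_le, lt_sub_iff_add_lt]
  by_cases hp : p ∈ auxS ρ (x - s) (y - ρ * s)
  · have hp2 := this.2 hp
    simp [Set.indicator_of_mem hp, Set.indicator_of_mem hp2]
  · have hp2 := fun h => hp (this.1 h)
    simp [Set.indicator_of_notMem hp, Set.indicator_of_notMem hp2]

lemma aux_g_int (ρ : ℝ) (hρ : ρ ∈ Set.Ioo (-1 : ℝ) 1) :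
    Integrable (fun p : ℝ × ℝ =>
      Real.exp (-(p.1 ^ 2 + p.2 ^ 2 - 2 * ρ * p.1 * p.2) / (2 * (1 - ρ ^ 2)))) := by
  have h0 : 0 < 1 - ρ ^ 2 := by nlinarith [hρ.1, hρ.2]
  have hi := (integrable_exp_neg_mul_sq (b := 1/4) (by norm_num)).mul_prod
    (integrable_exp_neg_mul_sq (b := 1/4) (by norm_num))
  refine hi.mono' (by fun_prop) (.of_forall fun p => ?_)
  rw [Real.norm_eq_abs, Real.abs_exp, ← Real.exp_add, Real.exp_le_exp,
    div_le_iff₀ (by positivity)]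
  nlinarith [sq_nonneg (p.1 - ρ * p.2), sq_nonneg (p.2 - ρ * p.1), sq_nonneg (p.1 - p.2),
    sq_nonneg (p.1 + p.2), mul_nonneg (sub_nonneg.2 hρ.1.le) (sq_nonneg (p.1 + p.2)),
    mul_nonneg (sub_nonneg.2 hρ.2.le) (sq_nonneg (p.1 - p.2)), mul_pos h0 h0, mul_nonneg (sq_nonneg (1+ρ)) (sq_nonneg (p.1 + p.2)), mul_nonneg (sq_nonneg (1-ρ)) (sq_nonneg (p.1 - p.2))]

lemma aux_cdf (ρ x y : ℝ) (hρ : ρ ∈ Set.Ioo (-1 : ℝ) 1) :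
    biGaussianCDF x y ρ = ∫ p in auxS ρ x y,
      gaussianPDFReal 0 1 p.1 * gaussianPDFReal 0 1 p.2 := by
  have h0 : 0 < 1 - ρ ^ 2 := by nlinarith [hρ.1, hρ.2]
  have hr : Real.sqrt (1 - ρ ^ 2) ^ 2 = 1 - ρ ^ 2 := Real.sq_sqrt h0.le
  have hr0 : 0 < Real.sqrt (1 - ρ ^ 2) := Real.sqrt_pos.2 h0
  unfold biGaussianCDF
  set r := Real.sqrt (1 - ρ ^ 2) with hrdef
  rw [integral_integral_swap]
  swap
  · rw [Measure.prod_restrict]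
    exact (aux_g_int ρ hρ).integrableOn
  rw [← integral_indicator (auxS_meas _ _ _)]
  rw [Measure.volume_eq_prod, integral_prod _ (aux_int.indicator (auxS_meas _ _ _)),
    ← integral_const_mul, ← integral_Iic_eq_integral_Iio, ← integral_indicator measurableSet_Iic]
  refine integral_congr_ae (.of_forall fun t => ?_)
  by_cases ht : t ≤ y
  swap
  · simp [Set.indicator, auxS, ht]
  rw [Set.indicator_of_mem (Set.mem_Iic.2 ht)]
  have key : ∀ z : ℝ, (auxS ρ x y).indicator (fun p : ℝ × ℝ =>
      gaussianPDFReal 0 1 p.1 * gaussianPDFReal 0 1 p.2) (t, z) =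
      (fun w => (Set.Iio x).indicator (fun s => (2 * Real.pi)⁻¹ *
        Real.exp (-(s ^ 2 + t ^ 2 - 2 * ρ * s * t) / (2 * (1 - ρ ^ 2)))) (w + ρ * t)) (r * z) := by
    intro z
    have : (t, z) ∈ auxS ρ x y ↔ r * z + ρ * t ∈ Set.Iio x := by
      simp [auxS, ht, ← hrdef, add_comm]
    by_cases hp : (t, z) ∈ auxS ρ x y
    · have hp2 := this.1 hp
      simp only [Set.indicator_of_mem hp, Set.indicator_of_mem hp2]
      rw [aux_phiphi]
      congr 2
      rw [← hr]
      field_simp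
      linear_combination (-t ^ 2) * hr
    · have hp2 := fun h => hp (this.2 h)
      simp only [Set.indicator_of_notMem hp, Set.indicator_of_notMem hp2]
  beta_reduce
  rw [integral_congr_ae (.of_forall key)]
  refine Eq.trans ?_ (Measure.integral_comp_mul_left (fun w : ℝ =>
    (Set.Iio x).indicator (fun s => (2 * Real.pi)⁻¹ *
      Real.exp (-(s ^ 2 + t ^ 2 - 2 * ρ * s * t) / (2 * (1 - ρ ^ 2)))) (w + ρ * t)) r).symm
  rw [integral_add_right_eq_self (fun w => (Set.Iio x).indicator (fun s => (2 * Real.pi)⁻¹ *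
        Real.exp (-(s ^ 2 + t ^ 2 - 2 * ρ * s * t) / (2 * (1 - ρ ^ 2)))) w),
    integral_indicator measurableSet_Iio, integral_const_mul, abs_of_pos (by positivity),
    smul_eq_mul, mul_inv]
  ring

/-- For a Gaussian vector `(X, Y)` with means `(μX, μY)`, variances `(vX, vY)` and
correlation `ρ`, built from two independent standard Gaussians, and `u, c > 0`, `d ∈ ℝ`,
`E[(u - c e^Y)₊ 1_{X ≤ d}]
  = u Φ₂(w, ξ; ρ) - c e^{μY + vY/2} Φ₂(w - √vY, ξ - ρ√vY; ρ)`
with `w = (log(u/c) - μY)/√vY` and `ξ = (d - μX)/√vX`. -/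
theorem integral_pos_part_mul_indicator_bivariate {Ω : Type*} [MeasurableSpace Ω]
    (P : Measure Ω) [IsProbabilityMeasure P]
    (Z₁ Z₂ : Ω → ℝ) (hZ₁ : Measurable Z₁) (hZ₂ : Measurable Z₂)
    (h₁ : P.map Z₁ = gaussianReal 0 1) (h₂ : P.map Z₂ = gaussianReal 0 1)
    (hindep : IndepFun Z₁ Z₂ P)
    (ρ μX μY vX vY : ℝ) (hρ : ρ ∈ Set.Ioo (-1 : ℝ) 1) (hvX : 0 < vX) (hvY : 0 < vY)
    (u c d : ℝ) (hu : 0 < u) (hc : 0 < c)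
    (X Y : Ω → ℝ)
    (hX : X = fun ω => μX + Real.sqrt vX * Z₁ ω)
    (hY : Y = fun ω => μY + Real.sqrt vY * (ρ * Z₁ ω + Real.sqrt (1 - ρ ^ 2) * Z₂ ω)) :
    (∫ ω in {ω | X ω ≤ d}, max (u - c * Real.exp (Y ω)) 0 ∂P)
      = u * biGaussianCDF ((Real.log (u / c) - μY) / Real.sqrt vY)
            ((d - μX) / Real.sqrt vX) ρ
        - c * Real.exp (μY + vY / 2)
          * biGaussianCDF ((Real.log (u / c) - μY) / Real.sqrt vY - Real.sqrt vY)
              ((d - μX) / Real.sqrt vX - ρ * Real.sqrt vY) ρ := by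
  have h0 : 0 < 1 - ρ ^ 2 := by nlinarith [hρ.1, hρ.2]
  have hsX : 0 < Real.sqrt vX := Real.sqrt_pos.2 hvX
  have hsY : 0 < Real.sqrt vY := Real.sqrt_pos.2 hvY
  have hsq : Real.sqrt vY ^ 2 = vY := Real.sq_sqrt hvY.le
  rw [aux_cdf _ _ _ hρ, aux_cdf _ _ _ hρ, Real.exp_add]
  have hsh := aux_shift ρ (Real.sqrt vY) ((Real.log (u / c) - μY) / Real.sqrt vY)
    ((d - μX) / Real.sqrt vX) hρ
  rw [hsq] at hsh
  set S := auxS ρ ((Real.log (u / c) - μY) / Real.sqrt vY) ((d - μX) / Real.sqrt vX) with hS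
  have hSm : MeasurableSet S := auxS_meas _ _ _
  have hmX : MeasurableSet {ω | X ω ≤ d} := by
    subst hX
    exact measurableSet_le (by fun_prop) (by fun_prop)
  set F : ℝ × ℝ → ℝ := S.indicator (fun p => u - c * Real.exp μY *
    Real.exp (Real.sqrt vY * (ρ * p.1 + Real.sqrt (1 - ρ ^ 2) * p.2))) with hF
  have hFm : Measurable F := Measurable.indicator (by fun_prop) hSm
  have hstep : (∫ ω in {ω | X ω ≤ d}, max (u - c * Real.exp (Y ω)) 0 ∂P)
      = ∫ ω, F (Z₁ ω, Z₂ ω) ∂P := by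
    rw [← integral_indicator hmX]
    refine integral_congr_ae (.of_forall fun ω => ?_)
    have e1 : X ω ≤ d ↔ Z₁ ω ≤ (d - μX) / Real.sqrt vX := by
      rw [hX, le_div_iff₀ hsX]
      constructor <;> intro h <;> linarith
    have e2 : 0 < u - c * Real.exp (Y ω) ↔ ρ * Z₁ ω + Real.sqrt (1 - ρ ^ 2) * Z₂ ω <
        (Real.log (u / c) - μY) / Real.sqrt vY := by
      rw [sub_pos, mul_comm c, ← lt_div_iff₀ hc, ← Real.lt_log_iff_exp_lt (by positivity),
        lt_div_iff₀ hsY, hY]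
      constructor <;> intro h <;> linarith
    have e3 : c * Real.exp (Y ω) = c * Real.exp μY *
        Real.exp (Real.sqrt vY * (ρ * Z₁ ω + Real.sqrt (1 - ρ ^ 2) * Z₂ ω)) := by
      rw [hY, mul_assoc, ← Real.exp_add]
    beta_reduce
    by_cases hx : X ω ≤ d
    · by_cases hy : 0 < u - c * Real.exp (Y ω)
      · have hm : (Z₁ ω, Z₂ ω) ∈ S := ⟨e1.1 hx, e2.1 hy⟩
        rw [hF, Set.indicator_of_mem hm, Set.indicator_of_mem (by exact hx), max_eq_left hy.le, e3]
      · have hm : (Z₁ ω, Z₂ ω) ∉ S := fun h => hy (e2.2 h.2)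
        rw [hF, Set.indicator_of_notMem hm, Set.indicator_of_mem (by exact hx),
          max_eq_right (not_lt.1 hy)]
    · have hm : (Z₁ ω, Z₂ ω) ∉ S := fun h => hx (e1.2 h.1)
      rw [hF, Set.indicator_of_notMem hm, Set.indicator_of_notMem (by exact hx)]
  rw [hstep, aux_law P Z₁ Z₂ hZ₁ hZ₂ h₁ h₂ hindep F hFm]
  have hprod : ∀ p : ℝ × ℝ, F p * (gaussianPDFReal 0 1 p.1 * gaussianPDFReal 0 1 p.2) =
      S.indicator (fun p => u * (gaussianPDFReal 0 1 p.1 * gaussianPDFReal 0 1 p.2) -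
        c * Real.exp μY * (Real.exp (Real.sqrt vY * (ρ * p.1 + Real.sqrt (1 - ρ ^ 2) * p.2)) *
        (gaussianPDFReal 0 1 p.1 * gaussianPDFReal 0 1 p.2))) p := by
    intro p
    simp only [hF, Set.indicator]
    split_ifs
    · ring
    · ring
  simp_rw [hprod]
  rw [integral_indicator hSm, integral_sub (aux_int.integrableOn.const_mul _)
    ((aux_tilt_int ρ _ hρ).integrableOn.const_mul _), integral_const_mul, integral_const_mul, hsh]
  ring
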